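/- arXiv:2207.14387 — 7 statements merged into one kernel-verified Lean document; each statement's English description precedes it below -/
import Mathlib

section
/- Suppose W_x = X Xᵀ and W_g = Y Yᵀ are positive definite. Then all singular values σ₁ ≥ … ≥ σ_n of YᵀX are strictly positive, the matrix T = X V Σ^{−1/2} ∈ ℝⁿˣⁿ is invertible with T^{−1} = Σ^{−1/2} Uᵀ Yᵀ, and the change of coordinates T balances the two covariance matrices: T^{−1} W_x T^{−ᵀ} = Σ and Tᵀ W_g T = Σ, where Σ = diag(σ₁,…,σ_n). -/
open Matrix

/-- if `W_x = X Xᵀ` and `W_g = Y Yᵀ` are positive definite and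
`YᵀX = U Σ Vᵀ` is a reduced singular value decomposition (`U ∈ ℝˢᵍˣⁿ`, `V ∈ ℝˢˣˣⁿ`
with orthonormal columns, `Σ = diag(σ₁,…,σ_n)`, `σ₁ ≥ … ≥ σ_n ≥ 0`), then all the
singular values are strictly positive, `T = X V Σ^{−1/2}` is invertible with
`T⁻¹ = Σ^{−1/2} Uᵀ Yᵀ`, and `T` balances the covariances:
`T⁻¹ W_x T^{−ᵀ} = Σ` and `Tᵀ W_g T = Σ`. -/
theorem balancing_transformation (n sx sg : ℕ) (hsx : n ≤ sx) (hsg : n ≤ sg)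
    (X : Matrix (Fin n) (Fin sx) ℝ) (Y : Matrix (Fin n) (Fin sg) ℝ)
    (U : Matrix (Fin sg) (Fin n) ℝ) (V : Matrix (Fin sx) (Fin n) ℝ)
    (hU : Uᵀ * U = 1) (hV : Vᵀ * V = 1)
    (σ : Fin n → ℝ) (hσa : ∀ i j : Fin n, i ≤ j → σ j ≤ σ i) (hσ0 : ∀ i, 0 ≤ σ i)
    (hSVD : Yᵀ * X = U * Matrix.diagonal σ * Vᵀ)
    (hWx : (X * Xᵀ).PosDef) (hWg : (Y * Yᵀ).PosDef)
    (T Tinv : Matrix (Fin n) (Fin n) ℝ)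
    (hT : T = X * V * Matrix.diagonal (fun i => (Real.sqrt (σ i))⁻¹))
    (hTinv : Tinv = Matrix.diagonal (fun i => (Real.sqrt (σ i))⁻¹) * Uᵀ * Yᵀ) :
    (∀ i, 0 < σ i) ∧
    T * Tinv = 1 ∧ Tinv * T = 1 ∧
    Tinv * (X * Xᵀ) * Tinvᵀ = Matrix.diagonal σ ∧
    Tᵀ * (Y * Yᵀ) * T = Matrix.diagonal σ := by
  have hdet : (Matrix.diagonal σ).det ≠ 0 := by
    intro h0
    have h1 : (Y * Yᵀ) * (X * Xᵀ) = (Y * U) * Matrix.diagonal σ * (Vᵀ * Xᵀ) := by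
      calc (Y * Yᵀ) * (X * Xᵀ) = Y * (Yᵀ * X) * Xᵀ := by simp only [Matrix.mul_assoc]
        _ = _ := by rw [hSVD]; simp only [Matrix.mul_assoc]
    have h2 := congrArg Matrix.det h1
    rw [Matrix.det_mul, Matrix.det_mul (Y * U * _), Matrix.det_mul (Y * U), h0] at h2
    have := mul_pos hWg.det_pos hWx.det_pos
    rw [h2] at this
    simp at this
  have hpos : ∀ i, 0 < σ i := by
    intro i
    rw [Matrix.det_diagonal, Finset.prod_ne_zero_iff] at hdet
    exact lt_of_le_of_ne (hσ0 i) (Ne.symm (hdet i (Finset.mem_univ i)))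
  set D : Matrix (Fin n) (Fin n) ℝ := Matrix.diagonal (fun i => (Real.sqrt (σ i))⁻¹) with hD
  have hDt : Dᵀ = D := by rw [hD, Matrix.diagonal_transpose]
  have hs : ∀ i, (Real.sqrt (σ i))⁻¹ * σ i = Real.sqrt (σ i) := by
    intro i
    have h := Real.sqrt_pos.2 (hpos i)
    have h2 := Real.mul_self_sqrt (hσ0 i)
    field_simp
    nlinarith
  have hDS : D * Matrix.diagonal σ = Matrix.diagonal (fun i => Real.sqrt (σ i)) := by
    rw [hD, Matrix.diagonal_mul_diagonal]
    simp only [hs]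
  have hSD : Matrix.diagonal σ * D = Matrix.diagonal (fun i => Real.sqrt (σ i)) := by
    rw [hD, Matrix.diagonal_mul_diagonal]
    simp only [mul_comm (σ _), hs]
  have hSS : Matrix.diagonal (fun i => Real.sqrt (σ i)) * Matrix.diagonal (fun i => Real.sqrt (σ i))
      = Matrix.diagonal σ := by
    rw [Matrix.diagonal_mul_diagonal]
    simp only [Real.mul_self_sqrt (hσ0 _)]
  have hSiD : Matrix.diagonal (fun i => Real.sqrt (σ i)) * D = 1 := by
    rw [hD, Matrix.diagonal_mul_diagonal, ← Matrix.diagonal_one]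
    congr 1
    funext i
    exact mul_inv_cancel₀ (Real.sqrt_pos.2 (hpos i)).ne'
  have hA : Tinv * X = Matrix.diagonal (fun i => Real.sqrt (σ i)) * Vᵀ := by
    calc Tinv * X = D * Uᵀ * (Yᵀ * X) := by rw [hTinv]; simp only [Matrix.mul_assoc]
      _ = D * (Uᵀ * U) * Matrix.diagonal σ * Vᵀ := by rw [hSVD]; simp only [Matrix.mul_assoc]
      _ = _ := by rw [hU, Matrix.mul_one, hDS]
  have hB : Yᵀ * T = U * Matrix.diagonal (fun i => Real.sqrt (σ i)) := by
    calc Yᵀ * T = (Yᵀ * X) * V * D := by rw [hT]; simp only [Matrix.mul_assoc]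
      _ = U * (Matrix.diagonal σ * (Vᵀ * V) * D) := by rw [hSVD]; simp only [Matrix.mul_assoc]
      _ = _ := by rw [hV, Matrix.mul_one, hSD]
  have hinv : Tinv * T = 1 := by
    calc Tinv * T = (Tinv * X) * V * D := by rw [hT]; simp only [Matrix.mul_assoc]
      _ = Matrix.diagonal (fun i => Real.sqrt (σ i)) * (Vᵀ * V) * D := by
        rw [hA]; simp only [Matrix.mul_assoc]
      _ = 1 := by rw [hV, Matrix.mul_one, hSiD]
  refine ⟨hpos, mul_eq_one_comm.1 hinv, hinv, ?_, ?_⟩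
  · calc Tinv * (X * Xᵀ) * Tinvᵀ = (Tinv * X) * (Tinv * X)ᵀ := by
          rw [Matrix.transpose_mul]; simp only [Matrix.mul_assoc]
      _ = Matrix.diagonal (fun i => Real.sqrt (σ i)) * (Vᵀ * V)
            * Matrix.diagonal (fun i => Real.sqrt (σ i)) := by
          rw [hA, Matrix.transpose_mul, Matrix.transpose_transpose, Matrix.diagonal_transpose]
          simp only [Matrix.mul_assoc]
      _ = _ := by rw [hV, Matrix.mul_one, hSS]
  · calc Tᵀ * (Y * Yᵀ) * T = (Yᵀ * T)ᵀ * (Yᵀ * T) := by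
          rw [Matrix.transpose_mul, Matrix.transpose_transpose]; simp only [Matrix.mul_assoc]
      _ = Matrix.diagonal (fun i => Real.sqrt (σ i)) * (Uᵀ * U)
            * Matrix.diagonal (fun i => Real.sqrt (σ i)) := by
          rw [hB, Matrix.transpose_mul, Matrix.diagonal_transpose]
          simp only [Matrix.mul_assoc]
      _ = _ := by rw [hU, Matrix.mul_one, hSS]
end

section
/- Suppose W_x = X Xᵀ and W_g = Y Yᵀ are positive definite, let T = X V Σ^{−1/2} with inverse T^{−1} = Σ^{−1/2} Uᵀ Yᵀ, and let P = ΦΨᵀ with Φ = X V_r Σ_r^{−1/2} and Ψ = Y U_r Σ_r^{−1/2} built from the rank-r truncation of the singular value decomposition. Then T^{−1} P T is the block-diagonal truncation matrix with the r×r identity in the upper-left block and zeros elsewhere. -/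
open Matrix

/-- with `W_x = X Xᵀ`, `W_g = Y Yᵀ` positive definite, the balancing
transformation `T = X V Σ^{−1/2}` with `T⁻¹ = Σ^{−1/2} Uᵀ Yᵀ`, and the oblique
projection `P = ΦΨᵀ` (`Φ = X V_r Σ_r^{−1/2}`, `Ψ = Y U_r Σ_r^{−1/2}` built from the
rank-`r` truncation of the reduced singular value decomposition `YᵀX = U Σ Vᵀ`,
`σ₁ ≥ … ≥ σ_n > 0`), the matrix `T⁻¹ P T` is the block-diagonal truncation matrix with
the `r×r` identity in the upper-left block and zeros elsewhere. -/
theorem balanced_coordinates_truncation (n sx sg r : ℕ)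
    (hsx : n ≤ sx) (hsg : n ≤ sg) (hrn : r ≤ n)
    (X : Matrix (Fin n) (Fin sx) ℝ) (Y : Matrix (Fin n) (Fin sg) ℝ)
    (U : Matrix (Fin sg) (Fin n) ℝ) (V : Matrix (Fin sx) (Fin n) ℝ)
    (hU : Uᵀ * U = 1) (hV : Vᵀ * V = 1)
    (σ : Fin n → ℝ) (hσa : ∀ i j : Fin n, i ≤ j → σ j ≤ σ i) (hσ0 : ∀ i, 0 < σ i)
    (hSVD : Yᵀ * X = U * Matrix.diagonal σ * Vᵀ)
    (hWx : (X * Xᵀ).PosDef) (hWg : (Y * Yᵀ).PosDef)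
    (T Tinv : Matrix (Fin n) (Fin n) ℝ)
    (hT : T = X * V * Matrix.diagonal (fun i => (Real.sqrt (σ i))⁻¹))
    (hTinv : Tinv = Matrix.diagonal (fun i => (Real.sqrt (σ i))⁻¹) * Uᵀ * Yᵀ)
    (Ur : Matrix (Fin sg) (Fin r) ℝ) (hUr : ∀ i j, Ur i j = U i (Fin.castLE hrn j))
    (Vr : Matrix (Fin sx) (Fin r) ℝ) (hVr : ∀ i j, Vr i j = V i (Fin.castLE hrn j))
    (Φ : Matrix (Fin n) (Fin r) ℝ)
    (hΦ : Φ = X * Vr * Matrix.diagonal (fun i : Fin r => (Real.sqrt (σ (Fin.castLE hrn i)))⁻¹))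
    (Ψ : Matrix (Fin n) (Fin r) ℝ)
    (hΨ : Ψ = Y * Ur * Matrix.diagonal (fun i : Fin r => (Real.sqrt (σ (Fin.castLE hrn i)))⁻¹))
    (P : Matrix (Fin n) (Fin n) ℝ) (hP : P = Φ * Ψᵀ) :
    Tinv * P * T =
      Matrix.of (fun i j : Fin n => if i = j ∧ (i : ℕ) < r then (1 : ℝ) else 0) := by
  have hTT : Tinv * T = 1 := by
    have h1 : Tinv * T = Matrix.diagonal (fun i => (Real.sqrt (σ i))⁻¹) *
        (Uᵀ * (Yᵀ * X) * V) * Matrix.diagonal (fun i => (Real.sqrt (σ i))⁻¹) := by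
      rw [hT, hTinv]; simp only [Matrix.mul_assoc]
    have h2 : Uᵀ * (Yᵀ * X) * V = Matrix.diagonal σ := by
      rw [hSVD]
      calc Uᵀ * (U * Matrix.diagonal σ * Vᵀ) * V
          = (Uᵀ * U) * Matrix.diagonal σ * (Vᵀ * V) := by simp only [Matrix.mul_assoc]
        _ = _ := by rw [hU, hV, Matrix.one_mul, Matrix.mul_one]
    rw [h1, h2, Matrix.diagonal_mul_diagonal, Matrix.diagonal_mul_diagonal,
      ← Matrix.diagonal_one]
    congr 1
    funext i
    have hp : Real.sqrt (σ i) ≠ 0 := (Real.sqrt_pos.mpr (hσ0 i)).ne'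
    have hs : Real.sqrt (σ i) * Real.sqrt (σ i) = σ i := Real.mul_self_sqrt (hσ0 i).le
    calc (Real.sqrt (σ i))⁻¹ * σ i * (Real.sqrt (σ i))⁻¹
        = (Real.sqrt (σ i))⁻¹ * (Real.sqrt (σ i) * Real.sqrt (σ i)) * (Real.sqrt (σ i))⁻¹ := by
          rw [hs]
      _ = 1 := by field_simp
  have hΦ' : ∀ i j, Φ i j = T i (Fin.castLE hrn j) := by
    intro i j
    rw [hΦ, hT, Matrix.mul_diagonal, Matrix.mul_diagonal]
    simp only [Matrix.mul_apply, hVr]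
  have hΨ' : ∀ i j, Ψ i j = Tinv (Fin.castLE hrn j) i := by
    intro i j
    rw [hΨ, hTinv, Matrix.mul_diagonal, Matrix.mul_assoc, Matrix.diagonal_mul, mul_comm]
    simp only [Matrix.mul_apply, hUr, Matrix.transpose_apply]
    congr 1
    exact Finset.sum_congr rfl fun _ _ => mul_comm _ _
  have hA : ∀ i k, (Tinv * Φ) i k = if i = Fin.castLE hrn k then 1 else 0 := by
    intro i k
    rw [← Matrix.one_apply, ← hTT]
    simp only [Matrix.mul_apply, hΦ']
  have hB : ∀ k j, (Ψᵀ * T) k j = if Fin.castLE hrn k = j then 1 else 0 := by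
    intro k j
    rw [← Matrix.one_apply, ← hTT]
    simp only [Matrix.mul_apply, Matrix.transpose_apply, hΨ']
  have hfin : Tinv * P * T = (Tinv * Φ) * (Ψᵀ * T) := by
    rw [hP]; simp only [Matrix.mul_assoc]
  rw [hfin]
  ext i j
  rw [Matrix.mul_apply, Matrix.of_apply]
  simp only [hA, hB]
  by_cases hi : (i : ℕ) < r
  · rw [Finset.sum_eq_single (⟨i, hi⟩ : Fin r)]
    · have : Fin.castLE hrn ⟨i, hi⟩ = i := rfl
      simp [this, hi]
    · intro k _ hk
      have : i ≠ Fin.castLE hrn k := by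
        intro h
        apply hk
        ext
        simp [h]
      simp [this]
    · simp
  · rw [if_neg (fun h => hi h.2)]
    apply Finset.sum_eq_zero
    intro k _
    have : i ≠ Fin.castLE hrn k := by
      intro h
      apply hi
      rw [h]
      exact k.2
    simp [this]
end

section
/- Let M ∈ ℝᵐˣⁿ be a matrix with rank(M) = r and let r ≤ s ≤ n. Then almost every matrix X ∈ ℝⁿˣˢ with respect to Lebesgue measure has linearly independent columns and satisfies rank(M X) = r; that is, the set of X ∈ ℝⁿˣˢ that either fail to have linearly independent columns or satisfy rank(M X) < r has Lebesgue measure zero. -/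
open Matrix MeasureTheory

lemma ae_det_aux {n s k : ℕ} (P : Matrix (Fin k) (Fin n) ℝ) (Q : Matrix (Fin s) (Fin k) ℝ)
    (X₀ : Matrix (Fin n) (Fin s) ℝ) (h : P * X₀ * Q = 1) :
    ∀ᵐ X : Fin n → Fin s → ℝ, (P * Matrix.of X * Q).det ≠ 0 := by
  let Y₀ : Fin n → Fin s → ℝ := X₀
  let L : ℝ →ₗ[ℝ] (Fin n → Fin s → ℝ) := LinearMap.toSpanSingleton ℝ _ Y₀
  have hc : Continuous fun X : Fin n → Fin s → ℝ => (P * Matrix.of X * Q).det := by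
    have : Continuous fun X : Fin n → Fin s → ℝ => Matrix.of X := continuous_id
    exact ((continuous_const.matrix_mul this).matrix_mul continuous_const).matrix_det
  refine ae_mem_of_ae_add_linearMap_mem (μ := (volume : Measure ℝ)) L volume
    (s := {X | (P * Matrix.of X * Q).det ≠ 0}) ?_ ?_
  · exact (isOpen_ne_fun hc continuous_const).measurableSet
  · intro Y
    have key : ∀ t : ℝ, (P * Matrix.of (Y + L t) * Q).det
        = (-(P * Matrix.of Y * Q)).charpoly.eval t := by
      intro t
      rw [Matrix.eval_charpoly]
      congr 1
      have : Matrix.of (Y + L t) = Matrix.of Y + t • X₀ := rfl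
      rw [this, Matrix.mul_add, Matrix.add_mul, Matrix.mul_smul, Matrix.smul_mul, h,
        sub_neg_eq_add, add_comm, Matrix.smul_one_eq_diagonal]
      rfl
    have hne := (Matrix.charpoly_monic (-(P * Matrix.of Y * Q))).ne_zero
    have hfin := Polynomial.finite_setOfPred_isRoot hne
    have := hfin.measure_zero (volume : Measure ℝ)
    rw [ae_iff]
    convert this using 2
    ext t
    simp only [Set.mem_ofPred_eq, key, not_not, Polynomial.IsRoot]

lemma exists_rank_factor {m n r : ℕ} (M : Matrix (Fin m) (Fin n) ℝ) (hM : M.rank = r) :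
    ∃ (P : Matrix (Fin r) (Fin m) ℝ) (N : Matrix (Fin n) (Fin r) ℝ), P * M * N = 1 := by
  let f := Matrix.toLin' M
  have hr : Module.finrank ℝ (LinearMap.range f) = Module.finrank ℝ (Fin r → ℝ) := by
    rw [Module.finrank_fin_fun, ← hM]; rfl
  let e := LinearEquiv.ofFinrankEq _ _ hr
  obtain ⟨h, hh⟩ := (e.toLinearMap ∘ₗ f.rangeRestrict).exists_rightInverse_of_surjective
    (by rw [LinearMap.range_eq_top]; exact e.surjective.comp f.surjective_rangeRestrict)
  obtain ⟨p, hp⟩ := ((LinearMap.range f).subtype ∘ₗ e.symm.toLinearMap).exists_leftInverse_of_injective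
    (by rw [LinearMap.ker_eq_bot]; exact Subtype.val_injective.comp e.symm.injective)
  refine ⟨LinearMap.toMatrix' p, LinearMap.toMatrix' h, ?_⟩
  have : p ∘ₗ f ∘ₗ h = LinearMap.id := by
    ext1 x
    ext1
    have h1 := LinearMap.congr_fun hh (Pi.single x 1)
    have h2 := LinearMap.congr_fun hp (Pi.single x 1)
    simp only [LinearMap.comp_apply, LinearMap.id_apply, LinearEquiv.coe_coe] at h1 h2
    rw [← h1, e.symm_apply_apply, h1] at h2
    simpa using h2
  have := congrArg LinearMap.toMatrix' this
  rw [LinearMap.toMatrix'_comp, LinearMap.toMatrix'_comp, LinearMap.toMatrix'_id,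
    LinearMap.toMatrix'_toLin'] at this
  rw [Matrix.mul_assoc, this]

lemma exists_embed {s n : ℕ} (h : s ≤ n) :
    ∃ (P : Matrix (Fin s) (Fin n) ℝ) (N : Matrix (Fin n) (Fin s) ℝ), P * N = 1 := by
  refine ⟨(1 : Matrix (Fin n) (Fin n) ℝ).submatrix (Fin.castLE h) id,
    (1 : Matrix (Fin n) (Fin n) ℝ).submatrix id (Fin.castLE h), ?_⟩
  rw [← Matrix.submatrix_mul _ _ _ id _ Function.bijective_id, Matrix.one_mul]
  exact Matrix.submatrix_one _ (Fin.castLE_injective h)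

/-- If `M ∈ ℝᵐˣⁿ` has rank `r` and `r ≤ s ≤ n`, then the set of
`X ∈ ℝⁿˣˢ` (identified with Euclidean space of dimension `n·s` with Lebesgue measure)
that fail to have linearly independent columns or fail to satisfy `rank(M X) = r` has
Lebesgue measure zero. -/
theorem ae_linearIndependent_and_rank (m n s r : ℕ)
    (M : Matrix (Fin m) (Fin n) ℝ) (hM : M.rank = r)
    (hrs : r ≤ s) (hsn : s ≤ n) :
    volume {X : Fin n → Fin s → ℝ |
      ¬ (LinearIndependent ℝ (fun j : Fin s => fun i : Fin n => X i j) ∧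
          (M * Matrix.of X).rank = r)} = 0 := by
  rw [← ae_iff]
  obtain ⟨P₁, X₁, h₁⟩ := exists_embed hsn
  obtain ⟨P₂, N₂, h₂⟩ := exists_rank_factor M hM
  obtain ⟨A, B, hAB⟩ := exists_embed hrs
  have a₁ := ae_det_aux P₁ 1 X₁ (by rw [Matrix.mul_one, h₁])
  have a₂ := ae_det_aux (P₂ * M) B (N₂ * A) (by
    rw [← Matrix.mul_assoc, h₂, Matrix.one_mul, hAB])
  filter_upwards [a₁, a₂] with X b₁ b₂
  have c₁ := Matrix.rank_of_isUnit _ ((Matrix.isUnit_iff_isUnit_det _).2 b₁.isUnit)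
  have c₂ := Matrix.rank_of_isUnit _ ((Matrix.isUnit_iff_isUnit_det _).2 b₂.isUnit)
  rw [Fintype.card_fin] at c₁ c₂
  constructor
  · have h3 : s ≤ (Matrix.of X).rank := by
      rw [Matrix.mul_one] at c₁
      exact c₁.symm.le.trans (Matrix.rank_mul_le_right _ _)
    rw [Matrix.rank_eq_finrank_span_cols] at h3
    rw [linearIndependent_iff_card_le_finrank_span, Fintype.card_fin]
    exact h3
  · apply le_antisymm
    · exact (Matrix.rank_mul_le_left _ _).trans hM.le
    · have h4 := (Matrix.rank_mul_le_left (P₂ * M * Matrix.of X) B)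
      rw [c₂, Matrix.mul_assoc] at h4
      exact h4.trans (Matrix.rank_mul_le_right _ _)
end

section
/- Let F ∈ ℝᵐˣⁿ with rank(F) = r ≥ 1 and let X ∈ ℝⁿˣˢ with s < n − r. Then there exists a matrix F̃ ∈ ℝᵐˣⁿ with rank(F̃) = r, F̃ X = F X, and Range(F̃ᵀ) ≠ Range(Fᵀ). -/
open Matrix

/-- If `F ∈ ℝᵐˣⁿ` has rank `r ≥ 1` and `X ∈ ℝⁿˣˢ` with `s < n − r`, then
there is `F̃` with `rank(F̃) = r`, `F̃ X = F X`, and `Range(F̃ᵀ) ≠ Range(Fᵀ)`. -/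
theorem exists_rank_eq_mul_eq_range_ne (m n s r : ℕ)
    (F : Matrix (Fin m) (Fin n) ℝ) (hF : F.rank = r) (hr : 1 ≤ r)
    (X : Matrix (Fin n) (Fin s) ℝ) (hs : s < n - r) :
    ∃ Ft : Matrix (Fin m) (Fin n) ℝ, Ft.rank = r ∧ Ft * X = F * X ∧
      LinearMap.range Ftᵀ.mulVecLin ≠ LinearMap.range Fᵀ.mulVecLin := by
  have hw : ∃ w : Fin n → ℝ, w ≠ 0 ∧ F *ᵥ w = 0 ∧ Xᵀ *ᵥ w = 0 := by
    have h1 := F.mulVecLin.finrank_range_add_finrank_ker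
    have h2 : Module.finrank ℝ (LinearMap.range F.mulVecLin) = r := hF
    rw [h2, Module.finrank_fin_fun] at h1
    have h3 : LinearMap.ker (Xᵀ.mulVecLin.domRestrict (LinearMap.ker F.mulVecLin)) ≠ ⊥ := by
      apply LinearMap.ker_ne_bot_of_finrank_lt
      rw [Module.finrank_fin_fun]
      omega
    obtain ⟨w, hw, hw0⟩ := Submodule.exists_mem_ne_zero_of_ne_bot h3
    refine ⟨w.1, fun h => hw0 (Subtype.ext h), ?_, ?_⟩
    · exact LinearMap.mem_ker.1 w.2
    · exact LinearMap.mem_ker.1 hw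
  obtain ⟨w, hw0, hFw, hXw⟩ := hw
  have hww : w ⬝ᵥ w ≠ 0 := fun h => hw0 (dotProduct_self_eq_zero.1 h)
  have hu : ∃ u : Fin n → ℝ, F *ᵥ u ≠ 0 ∧ w ⬝ᵥ u = 0 := by
    have : ∃ u : Fin n → ℝ, F *ᵥ u ≠ 0 := by
      by_contra! h
      have : F = 0 := by
        apply Matrix.ext_of_mulVec_single
        intro i
        rw [h, Matrix.zero_mulVec]
      rw [this, Matrix.rank_zero] at hF
      omega
    obtain ⟨u, hu⟩ := this
    refine ⟨u - (w ⬝ᵥ u / w ⬝ᵥ w) • w, ?_, ?_⟩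
    · rw [mulVec_sub, mulVec_smul, hFw]; simpa using hu
    · rw [dotProduct_sub, dotProduct_smul, smul_eq_mul]; field_simp; simp
  obtain ⟨u, hu, hwu⟩ := hu
  have hinv : (1 + vecMulVec u w) * (1 - vecMulVec u w) = 1 := by
    have : vecMulVec u w * vecMulVec u w = 0 := by
      rw [vecMulVec_mul_vecMulVec, hwu]; simp
    rw [add_mul, mul_sub, mul_sub, this]; simp
  have hFt : F * (1 + vecMulVec u w) = F + vecMulVec (F *ᵥ u) w := by
    rw [Matrix.mul_add, Matrix.mul_one, mul_vecMulVec]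
  refine ⟨F * (1 + vecMulVec u w), ?_, ?_, ?_⟩
  · rw [rank_mul_eq_left_of_isUnit_det, hF]
    exact (Matrix.isUnit_iff_isUnit_det _).1 (IsUnit.of_mul_eq_one _ hinv)
  · rw [hFt, Matrix.add_mul, vecMulVec_mul, ← mulVec_transpose, hXw]; ext i j; simp [vecMulVec_apply]
  · rw [hFt]
    set Ft := F + vecMulVec (F *ᵥ u) w with hdef
    have hy : Ft *ᵥ w ≠ 0 := by
      rw [hdef, add_mulVec, hFw, vecMulVec_mulVec, zero_add]
      simpa using And.intro hw0 hu
    intro h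
    have : Ftᵀ.mulVecLin (Ft *ᵥ w) ∈ LinearMap.range Fᵀ.mulVecLin := h ▸ ⟨_, rfl⟩
    obtain ⟨z, hz⟩ := this
    rw [mulVecLin_apply, mulVecLin_apply, mulVec_transpose, mulVec_transpose] at hz
    have := congrArg (· ⬝ᵥ w) hz
    simp only [← dotProduct_mulVec, hFw, dotProduct_zero] at this
    exact hy (dotProduct_self_eq_zero.1 this.symm)
end

section
/- Let F ∈ ℝᵐˣⁿ with rank(F) = r, let X ∈ ℝⁿˣˢ have linearly independent columns with r ≤ s ≤ n and rank(F X) = r, and let V = Range(Fᵀ) ⊆ ℝⁿ. Then for every r-dimensional subspace W ⊆ ℝⁿ, the following are equivalent: (i) there exists F̃ ∈ ℝᵐˣⁿ with rank(F̃) = r, F̃ X = F X, and Range(F̃ᵀ) = W; (ii) Range(Xᵀ P_W) = Range(Xᵀ P_V), where P_W and P_V denote the orthogonal projections of ℝⁿ onto W and V respectively. -/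
open Matrix

/-- characterization of the row spaces of rank-`r` matrices `F̃` consistent
with the sampled data `F̃ X = F X`: for an `r`-dimensional subspace `W ⊆ ℝⁿ` (with
orthogonal projections `P_W`, `P_V` characterized as the symmetric idempotent matrices
with ranges `W` and `V = Range(Fᵀ)`), there exists `F̃` with `rank F̃ = r`, `F̃ X = F X`,
`Range(F̃ᵀ) = W` iff `Range(Xᵀ P_W) = Range(Xᵀ P_V)`. -/
theorem data_equivalent_subspaces_characterization (m n s r : ℕ)
    (F : Matrix (Fin m) (Fin n) ℝ) (hF : F.rank = r)
    (X : Matrix (Fin n) (Fin s) ℝ)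
    (hX : LinearIndependent ℝ (fun j : Fin s => fun i : Fin n => X i j))
    (hrs : r ≤ s) (hsn : s ≤ n) (hFX : (F * X).rank = r)
    (V : Submodule ℝ (Fin n → ℝ)) (hV : LinearMap.range Fᵀ.mulVecLin = V)
    (PV : Matrix (Fin n) (Fin n) ℝ) (hPV1 : PV * PV = PV) (hPV2 : PVᵀ = PV)
    (hPV3 : LinearMap.range PV.mulVecLin = V)
    (W : Submodule ℝ (Fin n → ℝ)) (hW : Module.finrank ℝ W = r)
    (PW : Matrix (Fin n) (Fin n) ℝ) (hPW1 : PW * PW = PW) (hPW2 : PWᵀ = PW)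
    (hPW3 : LinearMap.range PW.mulVecLin = W) :
    (∃ Ft : Matrix (Fin m) (Fin n) ℝ, Ft.rank = r ∧ Ft * X = F * X ∧
        LinearMap.range Ftᵀ.mulVecLin = W) ↔
      LinearMap.range (Xᵀ * PW).mulVecLin = LinearMap.range (Xᵀ * PV).mulVecLin := by
  have key : ∀ (a : ℕ) (A : Matrix (Fin n) (Fin a) ℝ),
      LinearMap.range (Xᵀ * A).mulVecLin
        = (LinearMap.range A.mulVecLin).map Xᵀ.mulVecLin := by
    intro a A
    rw [Matrix.mulVecLin_mul, LinearMap.range_comp]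
  have hV' : LinearMap.range (Xᵀ * PV).mulVecLin = LinearMap.range (F * X)ᵀ.mulVecLin := by
    rw [Matrix.transpose_mul, key, key, hPV3, hV]
  rw [hV', key, hPW3]
  constructor
  · rintro ⟨Ft, -, h2, h3⟩
    rw [← h2, Matrix.transpose_mul, key, h3]
  · intro h
    have hex : ∀ i : Fin m, ∃ w ∈ W, Xᵀ *ᵥ w = Xᵀ *ᵥ (F i) := by
      intro i
      have : (F * X)ᵀ *ᵥ (Pi.single i 1) ∈ W.map Xᵀ.mulVecLin := by
        rw [h]
        exact ⟨Pi.single i 1, rfl⟩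
      obtain ⟨w, hw, hw2⟩ := this
      refine ⟨w, hw, ?_⟩
      rw [Matrix.mulVecLin_apply] at hw2
      rw [hw2, Matrix.transpose_mul, ← Matrix.mulVec_mulVec]
      congr 1
      ext j
      simp
    choose w hw hw2 using hex
    have hmul : (Matrix.of w) * X = F * X := by
      ext i j
      have := congrFun (hw2 i) j
      simp only [Matrix.mulVec, dotProduct, Matrix.transpose_apply] at this
      simp only [Matrix.mul_apply, Matrix.of_apply]
      simpa only [mul_comm] using this
    have hle : LinearMap.range (Matrix.of w)ᵀ.mulVecLin ≤ W := by
      rw [Matrix.range_mulVecLin, Submodule.span_le]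
      rintro _ ⟨i, rfl⟩
      exact hw i
    have hr : r ≤ (Matrix.of w).rank := by
      rw [← hFX, ← hmul]
      exact Matrix.rank_mul_le_left _ _
    have hrt : (Matrix.of w).rank
        = Module.finrank ℝ (LinearMap.range (Matrix.of w)ᵀ.mulVecLin) := by
      rw [← Matrix.rank_transpose]
      rfl
    have heq := Submodule.eq_of_le_of_finrank_le hle (by rw [hW, ← hrt]; exact hr)
    exact ⟨Matrix.of w, by rw [hrt, heq, hW], hmul, heq⟩
end

section
/- Let Ω ⊂ ℝⁿ be a bounded open set with closure Ω̄, let H be a real Hilbert space, and let Φ : Ω̄ → H be a map such that the kernel K(x,y) := ⟨Φ(x), Φ(y)⟩_H extends to a twice continuously differentiable function on an open neighborhood of Ω̄ × Ω̄ in ℝⁿ × ℝⁿ. Then Φ is Fréchet differentiable at every x ∈ Ω, the derivative DΦ(x) : ℝⁿ → H satisfies ⟨DΦ(x)u, DΦ(y)v⟩_H = uᵀ H(x,y) v for all x, y ∈ Ω and u, v ∈ ℝⁿ, where H(x,y) is the n×n matrix with entries H(x,y)_{ij} = ∂²K/∂x_i∂y_j (x,y), and the map x ↦ DΦ(x) is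 continuous from Ω to the bounded linear operators ℝⁿ → H with the operator norm (i.e., Φ is C¹ on Ω). -/
open RealInnerProductSpace

open Filter Topology in
theorem aux_dd {E : Type*} [NormedAddCommGroup E] [NormedSpace ℝ E] (F : E × E → ℝ) (x y : E)
    (hF : ContDiffAt ℝ 2 F (x, y)) (ε : ℝ) (hε : 0 < ε) :
    ∃ δ > 0, ∀ a ∈ Metric.ball x δ, ∀ b ∈ Metric.ball x δ, ∀ c ∈ Metric.ball y δ,
      ∀ d ∈ Metric.ball y δ,
      |F (b, d) - F (b, c) - (F (a, d) - F (a, c))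
        - fderiv ℝ (fderiv ℝ F) (x, y) (0, d - c) (b - a, 0)| ≤ ε * ‖d - c‖ * ‖b - a‖ := by
  have hG : ContDiffAt ℝ 1 (fderiv ℝ F) (x, y) := hF.fderiv_right (by norm_num)
  have hs : HasStrictFDerivAt (fderiv ℝ F) (fderiv ℝ (fderiv ℝ F) (x, y)) (x, y) :=
    hG.hasStrictFDerivAt (by norm_num)
  have h1 := hs.isLittleO.def hε
  have h2 : ∀ᶠ p in 𝓝 (x, y), DifferentiableAt ℝ F p :=
    (hF.eventually (by simp)).mono fun p hp => hp.differentiableAt (by norm_num)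
  rw [Metric.eventually_nhds_iff_ball] at h1 h2
  obtain ⟨δ1, hδ1, h1⟩ := h1
  obtain ⟨δ2, hδ2, h2⟩ := h2
  refine ⟨min δ1 δ2, lt_min hδ1 hδ2, ?_⟩
  intro a ha b hb c hc d hd
  set G' := fderiv ℝ (fderiv ℝ F) (x, y) with hG'
  have mem : ∀ t ∈ Metric.ball x (min δ1 δ2), ∀ s ∈ Metric.ball y (min δ1 δ2),
      dist t x < δ1 ∧ dist t x < δ2 ∧ dist s y < δ1 ∧ dist s y < δ2 := by
    intro t ht s hs
    rw [Metric.mem_ball, lt_min_iff] at ht hs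
    exact ⟨ht.1, ht.2, hs.1, hs.2⟩
  have hd1 : ∀ t ∈ Metric.ball x (min δ1 δ2), ∀ s ∈ Metric.ball y (min δ1 δ2),
      HasFDerivAt (fun t' => F (t', s))
        ((fderiv ℝ F (t, s)).comp (ContinuousLinearMap.inl ℝ E E)) t := by
    intro t ht s hs
    obtain ⟨_, m2, _, m4⟩ := mem t ht s hs
    have := (h2 (t, s) (by rw [Metric.mem_ball, Prod.dist_eq]; exact max_lt m2 m4)).hasFDerivAt
    exact this.comp t (hasFDerivAt_prodMk_left t s)
  have key := (convex_ball x (min δ1 δ2)).norm_image_sub_le_of_norm_hasFDerivWithin_le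
    (f := fun t => F (t, d) - F (t, c) - (G' (0, d - c)).comp (ContinuousLinearMap.inl ℝ E E) t)
    (f' := fun t => (fderiv ℝ F (t, d)).comp (ContinuousLinearMap.inl ℝ E E)
      - (fderiv ℝ F (t, c)).comp (ContinuousLinearMap.inl ℝ E E)
      - (G' (0, d - c)).comp (ContinuousLinearMap.inl ℝ E E))
    (C := ε * ‖d - c‖)
    (fun t ht => (((hd1 t ht d hd).sub (hd1 t ht c hc)).sub
      (ContinuousLinearMap.hasFDerivAt _)).hasFDerivWithinAt)
    (by
      intro t ht
      obtain ⟨m1, m2, m3, m4⟩ := mem t ht d hd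
      obtain ⟨_, _, m5, m6⟩ := mem t ht c hc
      have := h1 ((t, d), (t, c)) (by
        simp only [Metric.mem_ball, Prod.dist_eq]
        exact max_lt (max_lt m1 m3) (max_lt m1 m5))
      simp only [Prod.mk_sub_mk, sub_self, Prod.norm_mk, norm_zero] at this
      rw [max_eq_right (norm_nonneg _)] at this
      rw [← ContinuousLinearMap.sub_comp, ← ContinuousLinearMap.sub_comp]
      refine le_trans (ContinuousLinearMap.opNorm_comp_le _ _) ?_
      refine le_trans (mul_le_of_le_one_right (norm_nonneg _) ?_) this
      exact ContinuousLinearMap.norm_inl_le_one ℝ E E)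
    ha hb
  rw [Real.norm_eq_abs] at key
  convert key using 2
  have : ((b - a, 0) : E × E) = (b, 0) - (a, 0) := by simp
  rw [this, map_sub]
  simp
  ring

open Filter Topology in
theorem aux_main {E H : Type*} [NormedAddCommGroup E] [NormedSpace ℝ E] [FiniteDimensional ℝ E]
    [NormedAddCommGroup H] [InnerProductSpace ℝ H] [CompleteSpace H]
    (Ω : Set E) (hΩ : IsOpen Ω) (Φ : E → H) (F : E × E → ℝ)
    (hF : ∀ x ∈ Ω, ∀ y ∈ Ω, ContDiffAt ℝ 2 F (x, y))
    (hker : ∀ x ∈ Ω, ∀ y ∈ Ω, F (x, y) = ⟪Φ x, Φ y⟫) :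
    ∃ L : E → E →L[ℝ] H, (∀ x ∈ Ω, HasFDerivAt Φ (L x) x) ∧
      ∀ x ∈ Ω, ∀ y ∈ Ω, ∀ u v, ⟪L x u, L y v⟫ =
        fderiv ℝ (fderiv ℝ F) (x, y) (0, v) (u, 0) := by
  set B : E → E → E → E → ℝ := fun x y u v => fderiv ℝ (fderiv ℝ F) (x, y) (0, v) (u, 0) with hB
  have Bsmul : ∀ x y u v (s t : ℝ), B x y (s • u) (t • v) = s * t * B x y u v := by
    intro x y u v s t
    have e1 : ((0, t • v) : E × E) = t • (0, v) := by simp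
    have e2 : ((s • u, 0) : E × E) = s • (u, 0) := by simp
    simp only [hB]
    rw [e1, e2, map_smul, map_smul]
    simp
    ring
  have Baddl : ∀ x y u u' v, B x y (u + u') v = B x y u v + B x y u' v := by
    intro x y u u' v
    have e2 : ((u + u', 0) : E × E) = (u, 0) + (u', 0) := by simp
    simp only [hB]
    rw [e2, map_add]
  have Baddr : ∀ x y u v v', B x y u (v + v') = B x y u v + B x y u v' := by
    intro x y u v v'
    have e2 : ((0, v + v') : E × E) = (0, v) + (0, v') := by simp
    simp only [hB]
    rw [e2, map_add]
    rfl
  have dd : ∀ x ∈ Ω, ∀ y ∈ Ω, ∀ ε > 0, ∃ δ > 0, ∀ a ∈ Metric.ball x δ, ∀ b ∈ Metric.ball x δ,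
      ∀ c ∈ Metric.ball y δ, ∀ d ∈ Metric.ball y δ,
      |⟪Φ b - Φ a, Φ d - Φ c⟫ - B x y (b - a) (d - c)| ≤ ε * ‖d - c‖ * ‖b - a‖ := by
    intro x hx y hy ε hε
    obtain ⟨δ, hδ, h⟩ := aux_dd F x y (hF x hx y hy) ε hε
    obtain ⟨r1, hr1, h1⟩ := Metric.isOpen_iff.1 hΩ x hx
    obtain ⟨r2, hr2, h2⟩ := Metric.isOpen_iff.1 hΩ y hy
    refine ⟨min δ (min r1 r2), lt_min hδ (lt_min hr1 hr2), ?_⟩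
    intro a ha b hb c hc d hd
    simp only [Metric.mem_ball, lt_min_iff] at ha hb hc hd
    have := h a ha.1 b hb.1 c hc.1 d hd.1
    rw [hker b (h1 hb.2.1) d (h2 hd.2.2), hker b (h1 hb.2.1) c (h2 hc.2.2),
      hker a (h1 ha.2.1) d (h2 hd.2.2), hker a (h1 ha.2.1) c (h2 hc.2.2)] at this
    rw [inner_sub_left, inner_sub_right, inner_sub_right]
    exact this
  set q : E → E → ℝ → H := fun x u t => t⁻¹ • (Φ (x + t • u) - Φ x) with hq
  have near : ∀ (x u : E) (δ : ℝ), 0 < δ → ∀ᶠ t : ℝ in 𝓝[≠] 0, t ≠ 0 ∧ x + t • u ∈ Metric.ball x δ := by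
    intro x u δ hδ
    have hc : Tendsto (fun t : ℝ => x + t • u) (𝓝 0) (𝓝 x) := by
      have : Continuous (fun t : ℝ => x + t • u) := by fun_prop
      simpa using this.tendsto 0
    exact (eventually_mem_nhdsWithin).and
      ((hc.eventually (Metric.ball_mem_nhds x hδ)).filter_mono nhdsWithin_le_nhds)
  have T1 : ∀ x ∈ Ω, ∀ y ∈ Ω, ∀ u v, Tendsto (fun p : ℝ × ℝ => ⟪q x u p.1, q y v p.2⟫)
      (𝓝[≠] 0 ×ˢ 𝓝[≠] 0) (𝓝 (B x y u v)) := by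
    intro x hx y hy u v
    rw [Metric.tendsto_nhds]
    intro ε hε
    have hη : 0 < ε / (‖v‖ * ‖u‖ + 1) := by positivity
    obtain ⟨δ, hδ, h⟩ := dd x hx y hy _ hη
    filter_upwards [(near x u δ hδ).prod_mk (near y v δ hδ)] with p hp
    obtain ⟨⟨hs, hs'⟩, ht, ht'⟩ := hp
    have := h x (Metric.mem_ball_self hδ) _ hs' y (Metric.mem_ball_self hδ) _ ht'
    rw [add_sub_cancel_left, add_sub_cancel_left, Bsmul] at this
    have e : ⟪Φ (x + p.1 • u) - Φ x, Φ (y + p.2 • v) - Φ y⟫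
        = p.1 * p.2 * ⟪q x u p.1, q y v p.2⟫ := by
      simp only [hq]
      rw [real_inner_smul_left, real_inner_smul_right]
      field_simp
    rw [e, ← mul_sub, abs_mul, abs_mul, norm_smul, norm_smul, Real.norm_eq_abs,
      Real.norm_eq_abs] at this
    have hs2 : 0 < |p.1| := abs_pos.2 hs
    have ht2 : 0 < |p.2| := abs_pos.2 ht
    have h3 : |⟪q x u p.1, q y v p.2⟫ - B x y u v| ≤ ε / (‖v‖ * ‖u‖ + 1) * (‖v‖ * ‖u‖) := by
      refine le_of_mul_le_mul_left (this.trans (le_of_eq ?_)) (mul_pos hs2 ht2)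
      ring
    rw [Real.dist_eq]
    refine h3.trans_lt ?_
    rw [div_mul_eq_mul_div, div_lt_iff₀ (by positivity)]
    nlinarith
  have lim : ∀ x ∈ Ω, ∀ u, ∃ l, Tendsto (q x u) (𝓝[≠] 0) (𝓝 l) := by
    intro x hx u
    rw [← cauchy_map_iff_exists_tendsto, cauchy_map_iff]
    refine ⟨inferInstance, ?_⟩
    rw [tendsto_uniformity_iff_dist_tendsto_zero]
    have t0 := T1 x hx x hx u u
    have d1 : Tendsto (fun t => ⟪q x u t, q x u t⟫) (𝓝[≠] 0) (𝓝 (B x x u u)) :=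
      t0.comp (tendsto_id.prodMk tendsto_id)
    have t1 := d1.comp (tendsto_fst (f := 𝓝[≠] (0:ℝ)) (g := 𝓝[≠] (0:ℝ)))
    have t2 := d1.comp (tendsto_snd (f := 𝓝[≠] (0:ℝ)) (g := 𝓝[≠] (0:ℝ)))
    have t3 := ((t1.sub (t0.const_mul 2)).add t2).sqrt
    have e0 : √(B x x u u - 2 * B x x u u + B x x u u) = 0 := by
      rw [← Real.sqrt_zero]; congr 1; ring
    rw [e0] at t3
    refine t3.congr fun p => ?_
    simp only [Function.comp]
    rw [dist_eq_norm, real_inner_self_eq_norm_sq, real_inner_self_eq_norm_sq,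
      ← norm_sub_sq_real, Real.sqrt_sq (norm_nonneg _)]
  choose! l hl using lim
  have hlB : ∀ x ∈ Ω, ∀ y ∈ Ω, ∀ u v, ⟪l x u, l y v⟫ = B x y u v := by
    intro x hx y hy u v
    exact tendsto_nhds_unique
      (((hl x hx u).comp tendsto_fst).inner ((hl y hy v).comp tendsto_snd)) (T1 x hx y hy u v)
  have ladd : ∀ x ∈ Ω, ∀ u v, l x (u + v) = l x u + l x v := by
    intro x hx u v
    rw [← sub_eq_zero, ← inner_self_eq_zero (𝕜 := ℝ)]
    simp only [inner_sub_left, inner_sub_right, inner_add_left, inner_add_right, hlB x hx x hx,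
      Baddl, Baddr]
    ring
  have lsmul : ∀ x ∈ Ω, ∀ (s : ℝ) u, l x (s • u) = s • l x u := by
    intro x hx s u
    have b1 := Bsmul x x u u s s
    have b2 := Bsmul x x u u s 1
    have b3 := Bsmul x x u u 1 s
    rw [one_smul] at b2 b3
    rw [← sub_eq_zero, ← inner_self_eq_zero (𝕜 := ℝ)]
    simp only [inner_sub_left, inner_sub_right, real_inner_smul_left, real_inner_smul_right,
      hlB x hx x hx, b1, b2, b3]
    ring
  classical
  refine ⟨fun x => if hx : x ∈ Ω then LinearMap.toContinuousLinearMap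
    { toFun := l x, map_add' := ladd x hx, map_smul' := lsmul x hx } else 0, ?_, ?_⟩
  · intro x hx
    simp only [hx, dif_pos]
    rw [hasFDerivAt_iff_isLittleO]
    rw [Asymptotics.isLittleO_iff]
    intro c hc
    obtain ⟨δ, hδ, h⟩ := dd x hx x hx (c ^ 2 / 3) (by positivity)
    filter_upwards [Metric.ball_mem_nhds x hδ] with b hb
    have hx' := Metric.mem_ball_self (x := x) hδ
    have h1 := h x hx' b hb x hx' b hb
    have h2 : |⟪Φ b - Φ x, l x (b - x)⟫ - B x x (b - x) (b - x)|
        ≤ c ^ 2 / 3 * ‖b - x‖ * ‖b - x‖ := by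
      have tt : Tendsto (fun t => |⟪Φ b - Φ x, q x (b - x) t⟫ - B x x (b - x) (b - x)|) (𝓝[≠] 0)
          (𝓝 |⟪Φ b - Φ x, l x (b - x)⟫ - B x x (b - x) (b - x)|) :=
        ((tendsto_const_nhds.inner (hl x hx (b - x))).sub tendsto_const_nhds).abs
      refine le_of_tendsto tt ?_
      filter_upwards [near x (b - x) δ hδ] with t ht
      have h3 := h x hx' b hb x hx' _ ht.2
      have b3 := Bsmul x x (b - x) (b - x) 1 t
      rw [one_smul, one_mul] at b3
      have e : ⟪Φ b - Φ x, Φ (x + t • (b - x)) - Φ x⟫ = t * ⟪Φ b - Φ x, q x (b - x) t⟫ := by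
        simp only [hq]
        rw [real_inner_smul_right, mul_inv_cancel_left₀ ht.1]
      rw [add_sub_cancel_left, b3, e, ← mul_sub, abs_mul, norm_smul, Real.norm_eq_abs] at h3
      refine le_of_mul_le_mul_left (h3.trans (le_of_eq ?_)) (abs_pos.2 ht.1)
      ring
    change ‖Φ b - Φ x - l x (b - x)‖ ≤ c * ‖b - x‖
    refine abs_le_of_sq_le_sq' ?_ (by positivity) |>.2
    rw [norm_sub_sq_real, ← real_inner_self_eq_norm_sq, ← real_inner_self_eq_norm_sq,
      hlB x hx x hx]
    have h1' := (abs_le.1 h1).2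
    have h2' := (abs_le.1 h2).1
    nlinarith
  · intro x hx y hy u v
    simp only [hx, hy, dif_pos]
    exact hlB x hx y hy u v

theorem aux_lim {X V : Type*} [TopologicalSpace X] [NormedAddCommGroup V] [NormedSpace ℝ V]
    (x : X) (a b : X → V) (ha : ContinuousAt a x) (hb : ContinuousAt b x) (hab : a x = b x) :
    Filter.Tendsto (fun y => √‖a x - (2 : ℝ) • a y + b y‖) (nhds x) (nhds 0) := by
  have := (((continuousAt_const (y := a x)).sub
    (ha.const_smul (2 : ℝ))).add hb).norm.sqrt.tendsto
  have e : √‖a x - (2 : ℝ) • a x + b x‖ = 0 := by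
    rw [Real.sqrt_eq_zero (norm_nonneg _), norm_eq_zero, two_smul, hab]
    abel
  rw [← e]
  exact this

theorem aux_final {E : Type*} [NormedAddCommGroup E] [NormedSpace ℝ E] [FiniteDimensional ℝ E]
    {H : Type*} [NormedAddCommGroup H] [InnerProductSpace ℝ H] [CompleteSpace H]
    (Ω : Set E) (hΩo : IsOpen Ω)
    (Φ : E → H)
    (U : Set (E × E))
    (hUo : IsOpen U) (hUsub : (closure Ω) ×ˢ (closure Ω) ⊆ U)
    (K : E → E → ℝ)
    (hKsmooth : ContDiffOn ℝ 2 (fun p => K p.1 p.2) U)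
    (hker : ∀ x ∈ closure Ω, ∀ y ∈ closure Ω, K x y = ⟪Φ x, Φ y⟫) :
    (∀ x ∈ Ω, DifferentiableAt ℝ Φ x) ∧
    (∀ x ∈ Ω, ∀ y ∈ Ω, ∀ u v : E,
      ⟪fderiv ℝ Φ x u, fderiv ℝ Φ y v⟫ =
        fderiv ℝ (fun y' => fderiv ℝ (fun x' => K x' y') x u) y v) ∧
    ContinuousOn (fun x => fderiv ℝ Φ x) Ω := by
  have hF : ∀ x ∈ Ω, ∀ y ∈ Ω, ContDiffAt ℝ 2 (fun p => K p.1 p.2) (x, y) := fun x hx y hy =>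
    hKsmooth.contDiffAt (hUo.mem_nhds (hUsub ⟨subset_closure hx, subset_closure hy⟩))
  obtain ⟨L, hL, hLB⟩ := aux_main Ω hΩo Φ (fun p => K p.1 p.2) hF
    (fun x hx y hy => hker x (subset_closure hx) y (subset_closure hy))
  set F : E × E → ℝ := fun p => K p.1 p.2 with hFdef
  have hd1 : ∀ x ∈ Ω, ∀ y ∈ Ω, ∀ u,
      fderiv ℝ (fun x' => K x' y) x u = fderiv ℝ F (x, y) (u, 0) := by
    intro x hx y hy u
    have h1 := ((hF x hx y hy).differentiableAt (by norm_num)).hasFDerivAt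
    have h2 : HasFDerivAt (fun x' => K x' y) _ x :=
      HasFDerivAt.comp (g := F) (f := fun x' => (x', y)) x h1 (hasFDerivAt_prodMk_left x y)
    rw [h2.fderiv]
    simp
  have hG : ∀ x ∈ Ω, ∀ y ∈ Ω, ContDiffAt ℝ 1 (fderiv ℝ F) (x, y) := fun x hx y hy =>
    (hF x hx y hy).fderiv_right (by norm_num)
  refine ⟨fun x hx => (hL x hx).differentiableAt, ?_, ?_⟩
  · intro x hx y hy u v
    rw [(hL x hx).fderiv, (hL y hy).fderiv, hLB x hx y hy]
    have ev : (fun y' => fderiv ℝ (fun x' => K x' y') x u) =ᶠ[nhds y]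
        fun y' => fderiv ℝ F (x, y') (u, 0) := by
      filter_upwards [hΩo.mem_nhds hy] with y' hy'
      exact hd1 x hx y' hy' u
    rw [ev.fderiv_eq]
    have h1 := ((hG x hx y hy).differentiableAt (by norm_num)).hasFDerivAt
    have h2 : HasFDerivAt (fun y' => fderiv ℝ F (x, y')) _ y :=
      h1.comp y (hasFDerivAt_prodMk_right x y)
    have h3 := h2.clm_apply (hasFDerivAt_const ((u, 0) : E × E) y)
    rw [h3.fderiv]
    simp
  · intro x hx
    apply ContinuousAt.continuousWithinAt
    have hc : ∀ a ∈ Ω, ∀ b ∈ Ω, ContinuousAt (fderiv ℝ (fderiv ℝ F)) (a, b) := fun a ha b hb =>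
      ((hG a ha b hb).fderiv_right (m := 0) (by norm_num)).continuousAt
    have c1 : ContinuousAt (fun y => fderiv ℝ (fderiv ℝ F) (x, y)) x :=
      (hc x hx x hx).comp (f := fun y => (x, y)) (by fun_prop)
    have c2 : ContinuousAt (fun y => fderiv ℝ (fderiv ℝ F) (y, y)) x :=
      (hc x hx x hx).comp (f := fun y => (y, y)) (by fun_prop)
    have c3 : Filter.Tendsto (fun y => √‖fderiv ℝ (fderiv ℝ F) (x, x)
        - (2 : ℝ) • fderiv ℝ (fderiv ℝ F) (x, y) + fderiv ℝ (fderiv ℝ F) (y, y)‖)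
        (nhds x) (nhds 0) := by
      exact aux_lim x (fun y => fderiv ℝ (fderiv ℝ F) (x, y))
        (fun y => fderiv ℝ (fderiv ℝ F) (y, y)) c1 c2 rfl
    change Filter.Tendsto _ _ _
    rw [tendsto_iff_norm_sub_tendsto_zero]
    refine squeeze_zero' (Filter.Eventually.of_forall fun _ => norm_nonneg _) ?_ c3
    filter_upwards [hΩo.mem_nhds hx] with y hy
    rw [(hL x hx).fderiv, (hL y hy).fderiv, norm_sub_rev]
    refine ContinuousLinearMap.opNorm_le_bound _ (Real.sqrt_nonneg _) fun u => ?_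
    refine abs_le_of_sq_le_sq' ?_ (by positivity) |>.2
    rw [mul_pow, Real.sq_sqrt (by positivity), sub_apply, norm_sub_sq_real,
      ← real_inner_self_eq_norm_sq, ← real_inner_self_eq_norm_sq, hLB x hx x hx, hLB x hx y hy,
      hLB y hy y hy]
    set M := fderiv ℝ (fderiv ℝ F) (x, x)
        - (2 : ℝ) • fderiv ℝ (fderiv ℝ F) (x, y) + fderiv ℝ (fderiv ℝ F) (y, y) with hM
    have hb := M.le_opNorm₂ (0, u) (u, 0)
    simp only [Prod.norm_mk, norm_zero, max_eq_right (norm_nonneg u),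
      max_eq_left (norm_nonneg u)] at hb
    have hb2 := (le_abs_self _).trans hb
    have e : M (0, u) (u, 0) = fderiv ℝ (fderiv ℝ F) (x, x) (0, u) (u, 0)
        - 2 * fderiv ℝ (fderiv ℝ F) (x, y) (0, u) (u, 0)
        + fderiv ℝ (fderiv ℝ F) (y, y) (0, u) (u, 0) := by
      rw [hM]; rfl
    rw [e] at hb2
    nlinarith

/-- if `Ω ⊂ ℝⁿ` is bounded and open, `H` is a real Hilbert space, and
`Φ : Ω̄ → H` is such that the kernel `K(x,y) = ⟨Φ(x), Φ(y)⟩_H` extends to a `C²`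
function on an open neighborhood `U` of `Ω̄ × Ω̄`, then `Φ` is Fréchet differentiable on
`Ω`, the derivatives satisfy `⟨DΦ(x)u, DΦ(y)v⟩_H = uᵀ H(x,y) v` where `uᵀ H(x,y) v` is
the mixed second partial derivative of `K` in direction `u` in the first argument and
`v` in the second, and `x ↦ DΦ(x)` is continuous in the operator norm (`Φ` is `C¹`). -/
theorem feature_map_C1 (n : ℕ)
    {H : Type*} [NormedAddCommGroup H] [InnerProductSpace ℝ H] [CompleteSpace H]
    (Ω : Set (EuclideanSpace ℝ (Fin n))) (hΩo : IsOpen Ω)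
    (hΩb : Bornology.IsBounded Ω)
    (Φ : EuclideanSpace ℝ (Fin n) → H)
    (U : Set (EuclideanSpace ℝ (Fin n) × EuclideanSpace ℝ (Fin n)))
    (hUo : IsOpen U) (hUsub : (closure Ω) ×ˢ (closure Ω) ⊆ U)
    (K : EuclideanSpace ℝ (Fin n) → EuclideanSpace ℝ (Fin n) → ℝ)
    (hKsmooth : ContDiffOn ℝ 2 (fun p => K p.1 p.2) U)
    (hker : ∀ x ∈ closure Ω, ∀ y ∈ closure Ω, K x y = ⟪Φ x, Φ y⟫) :
    (∀ x ∈ Ω, DifferentiableAt ℝ Φ x) ∧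
    (∀ x ∈ Ω, ∀ y ∈ Ω, ∀ u v : EuclideanSpace ℝ (Fin n),
      ⟪fderiv ℝ Φ x u, fderiv ℝ Φ y v⟫ =
        fderiv ℝ (fun y' => fderiv ℝ (fun x' => K x' y') x u) y v) ∧
    ContinuousOn (fun x => fderiv ℝ Φ x) Ω := by
  exact aux_final Ω hΩo Φ U hUo hUsub K hKsmooth hker
end

section
/- Let α > 0, let p ≥ 2 be an integer, and let K(x,y) = (α + xᵀy)^p on ℝⁿ × ℝⁿ. Then the derivative Gram matrix G(x) with entries G(x)_{ij} = ∂²K/∂x_i∂y_j evaluated at (x,x) equals G(x) = p(α + ‖x‖²)^{p−1} I + p(p−1)(α + ‖x‖²)^{p−2} x xᵀ, and G(x) is invertible with G(x)^{−1} = (1 / (p(α + ‖x‖²)^{p−1})) [ I − ((p−1)/(α + p‖x‖²)) x xᵀ ]. -/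
open Matrix

/-- for the polynomial kernel `K(x,y) = (α + xᵀy)^p` with `α > 0` and
integer `p ≥ 2`, the derivative Gram matrix `G(x)`, with entries the mixed partials
`∂²K/∂x_i∂y_j` evaluated at `(x,x)`, equals
`p(α + ‖x‖²)^{p−1} I + p(p−1)(α + ‖x‖²)^{p−2} x xᵀ`, and it is invertible with inverse
`(1/(p(α + ‖x‖²)^{p−1})) [ I − ((p−1)/(α + p‖x‖²)) x xᵀ ]`. -/
theorem polynomial_kernel_gram_matrix (n : ℕ) (α : ℝ) (hα : 0 < α)
    (p : ℕ) (hp : 2 ≤ p)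
    (K : (Fin n → ℝ) → (Fin n → ℝ) → ℝ)
    (hK : ∀ x y, K x y = (α + x ⬝ᵥ y) ^ p)
    (G : (Fin n → ℝ) → Matrix (Fin n) (Fin n) ℝ)
    (hG : ∀ x i j, G x i j =
      fderiv ℝ (fun y => fderiv ℝ (fun z => K z y) x (Pi.single i 1)) x
        (Pi.single j 1)) :
    ∀ x : Fin n → ℝ,
      G x = ((p : ℝ) * (α + x ⬝ᵥ x) ^ (p - 1)) • (1 : Matrix (Fin n) (Fin n) ℝ)
          + ((p : ℝ) * ((p : ℝ) - 1) * (α + x ⬝ᵥ x) ^ (p - 2)) •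
              Matrix.of (fun i j => x i * x j) ∧
      G x * (((p : ℝ) * (α + x ⬝ᵥ x) ^ (p - 1))⁻¹ •
          ((1 : Matrix (Fin n) (Fin n) ℝ) -
            (((p : ℝ) - 1) / (α + (p : ℝ) * (x ⬝ᵥ x))) •
              Matrix.of (fun i j => x i * x j))) = 1 ∧
      (((p : ℝ) * (α + x ⬝ᵥ x) ^ (p - 1))⁻¹ •
          ((1 : Matrix (Fin n) (Fin n) ℝ) -
            (((p : ℝ) - 1) / (α + (p : ℝ) * (x ⬝ᵥ x))) •
              Matrix.of (fun i j => x i * x j))) * G x = 1 := by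
  obtain ⟨q, rfl⟩ : ∃ q, p = q + 2 := ⟨p - 2, by omega⟩
  intro x
  have hs : 0 ≤ x ⬝ᵥ x := by
    simp only [dotProduct]
    exact Finset.sum_nonneg fun i _ => mul_self_nonneg _
  let L : (Fin n → ℝ) → ((Fin n → ℝ) →L[ℝ] ℝ) := fun y =>
    ∑ i, y i • ContinuousLinearMap.proj (R := ℝ) (φ := fun _ : Fin n => ℝ) i
  have hL : ∀ y z, L y z = y ⬝ᵥ z := by
    intro y z
    simp [L, dotProduct]
  have h1 : ∀ y i, fderiv ℝ (fun z => K z y) x (Pi.single i 1)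
      = ((q : ℝ) + 2) * (α + x ⬝ᵥ y) ^ (q + 1) * y i := by
    intro y i
    have e : (fun z => K z y) = fun z => (α + L y z) ^ (q + 2) := by
      funext z
      rw [hK, hL, dotProduct_comm]
    have h := (((L y).hasFDerivAt (x := x)).const_add α).pow (q + 2)
    rw [e, h.fderiv]
    simp [hL, dotProduct_comm y x]
  have hGx : G x = (((q : ℝ) + 2) * (α + x ⬝ᵥ x) ^ (q + 1)) • (1 : Matrix (Fin n) (Fin n) ℝ)
          + (((q : ℝ) + 2) * ((q : ℝ) + 1) * (α + x ⬝ᵥ x) ^ q) •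
              Matrix.of (fun i j => x i * x j) := by
    ext i j
    rw [hG]
    simp only [h1]
    have e : (fun y : Fin n → ℝ => ((q : ℝ) + 2) * (α + x ⬝ᵥ y) ^ (q + 1) * y i)
        = fun y => (((q : ℝ) + 2) * (α + L x y) ^ (q + 1)) *
          (ContinuousLinearMap.proj (R := ℝ) (φ := fun _ : Fin n => ℝ) i) y := by
      funext y
      rw [hL]
      rfl
    have h := (((((L x).hasFDerivAt (x := x)).const_add α).pow (q + 1)).const_mul
      ((q : ℝ) + 2)).mul
      (ContinuousLinearMap.proj (R := ℝ) (φ := fun _ : Fin n => ℝ) i).hasFDerivAt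
    rw [e]
    erw [h.fderiv]
    simp [hL, Matrix.one_apply, Pi.single_apply]
    ring
  set s := x ⬝ᵥ x with hsdef
  set M : Matrix (Fin n) (Fin n) ℝ := Matrix.of (fun i j => x i * x j) with hM
  have hMM : M * M = s • M := by
    ext i j
    simp only [hM, hsdef, Matrix.mul_apply, Matrix.of_apply, Matrix.smul_apply, dotProduct,
      smul_eq_mul, Finset.sum_mul]
    exact Finset.sum_congr rfl fun k _ => by ring
  have hc : ((q + 2 : ℕ) : ℝ) = (q : ℝ) + 2 := by push_cast; ring
  have key : ∀ a b c d : ℝ, (a • (1 : Matrix (Fin n) (Fin n) ℝ) + b • M) * (c • (1 - d • M))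
      = (c * a) • (1 : Matrix (Fin n) (Fin n) ℝ) + (c * (b - a * d - b * d * s)) • M := by
    intro a b c d
    simp only [add_mul, mul_sub, smul_mul_assoc, mul_smul_comm, one_mul, mul_one, hMM]
    module
  have hq : (0 : ℝ) ≤ q := Nat.cast_nonneg q
  have hpos : 0 < α + s := by linarith
  have hd : 0 < α + ((q : ℝ) + 2) * s := by positivity
  have e1 : q + 2 - 1 = q + 1 := rfl
  have e2 : q + 2 - 2 = q := rfl
  have e3 : (q : ℝ) + 2 - 1 = q + 1 := by ring
  rw [hc, e1, e2, e3]
  have main : G x * ((((q : ℝ) + 2) * (α + s) ^ (q + 1))⁻¹ •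
      ((1 : Matrix (Fin n) (Fin n) ℝ) - (((q : ℝ) + 1) / (α + ((q : ℝ) + 2) * s)) • M)) = 1 := by
    rw [hGx, key, inv_mul_cancel₀ (by positivity)]
    have z : ((q : ℝ) + 2) * ((q : ℝ) + 1) * (α + s) ^ q
        - ((q : ℝ) + 2) * (α + s) ^ (q + 1) * (((q : ℝ) + 1) / (α + ((q : ℝ) + 2) * s))
        - ((q : ℝ) + 2) * ((q : ℝ) + 1) * (α + s) ^ q
          * (((q : ℝ) + 1) / (α + ((q : ℝ) + 2) * s)) * s = 0 := by
      field_simp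
      ring
    rw [z]
    simp
  exact ⟨hGx, main, mul_eq_one_comm.mp main⟩
end
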